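/- arXiv:2202.08998 — 2 statements merged into one kernel-verified Lean document; each statement's English description precedes it below -/
import Mathlib

section
/- For every orthonormal frame p = (n₁, n₂, n₃) of ℝ³ and all 3×3 real matrices A and B, one has A·B = Σ_{k=1}^{3} |V_k|^{-2} (A·V_k)(B·V_k) + Σ_{k=1}^{6} |W_k|^{-2} (A·W_k)(B·W_k), where V_k and W_k are the nine matrices associated with p. -/
open Matrix

noncomputable section

/-- Vectors of `ℝ³`. -/
abbrev V3 : Type := Fin 3 → ℝ

/-- Frobenius inner product of `3 × 3` real matrices. -/
def frob (A B : Matrix (Fin 3) (Fin 3) ℝ) : ℝ := ∑ i, ∑ j, A i j * B i j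

/-- The `3 × 3` matrix whose rows are the three given vectors. -/
def rowsOf (a b c : V3) : Matrix (Fin 3) (Fin 3) ℝ := Matrix.of ![a, b, c]

/-- `(n₁, n₂, n₃)` is an orthonormal frame of `ℝ³`. -/
def IsOrthoFrame (n₁ n₂ n₃ : V3) : Prop :=
  n₁ ⬝ᵥ n₁ = 1 ∧ n₂ ⬝ᵥ n₂ = 1 ∧ n₃ ⬝ᵥ n₃ = 1 ∧
  n₁ ⬝ᵥ n₂ = 0 ∧ n₁ ⬝ᵥ n₃ = 0 ∧ n₂ ⬝ᵥ n₃ = 0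

/-- The matrices `V₁, V₂, V₃` associated with a frame. -/
def Vmat (n₁ n₂ n₃ : V3) : Fin 3 → Matrix (Fin 3) (Fin 3) ℝ :=
  ![rowsOf 0 n₃ (-n₂), rowsOf (-n₃) 0 n₁, rowsOf n₂ (-n₁) 0]

/-- The matrices `W₁, …, W₆` associated with a frame. -/
def Wmat (n₁ n₂ n₃ : V3) : Fin 6 → Matrix (Fin 3) (Fin 3) ℝ :=
  ![rowsOf 0 n₃ n₂, rowsOf n₃ 0 n₁, rowsOf n₂ n₁ 0,
    rowsOf n₁ 0 0, rowsOf 0 n₂ 0, rowsOf 0 0 n₃]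

lemma rowsOf_zero (a b c : V3) : rowsOf a b c 0 = a := rfl
lemma rowsOf_one (a b c : V3) : rowsOf a b c 1 = b := rfl
lemma rowsOf_two (a b c : V3) : rowsOf a b c 2 = c := rfl

lemma frob_rowsOf (A : Matrix (Fin 3) (Fin 3) ℝ) (a b c : V3) :
    frob A (rowsOf a b c) = A 0 ⬝ᵥ a + A 1 ⬝ᵥ b + A 2 ⬝ᵥ c := by
  simp [frob, rowsOf, dotProduct, Fin.sum_univ_three]

lemma parseval (n₁ n₂ n₃ : V3) (h : IsOrthoFrame n₁ n₂ n₃) (x y : V3) :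
    x ⬝ᵥ y = (x ⬝ᵥ n₁) * (y ⬝ᵥ n₁) + (x ⬝ᵥ n₂) * (y ⬝ᵥ n₂) + (x ⬝ᵥ n₃) * (y ⬝ᵥ n₃) := by
  obtain ⟨h1, h2, h3, h4, h5, h6⟩ := h
  have hN : rowsOf n₁ n₂ n₃ * (rowsOf n₁ n₂ n₃)ᵀ = 1 := by
    ext i j
    have e : (rowsOf n₁ n₂ n₃ * (rowsOf n₁ n₂ n₃)ᵀ) i j
        = rowsOf n₁ n₂ n₃ i ⬝ᵥ rowsOf n₁ n₂ n₃ j := rfl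
    rw [e]
    fin_cases i <;> fin_cases j <;>
      simp [rowsOf_zero, rowsOf_one, rowsOf_two, h1, h2, h3, h4, h5, h6, dotProduct_comm n₂ n₁, dotProduct_comm n₃ n₁,
        dotProduct_comm n₃ n₂]
  have hM := mul_eq_one_comm.mp hN
  have key : x ⬝ᵥ y = (rowsOf n₁ n₂ n₃ *ᵥ x) ⬝ᵥ (rowsOf n₁ n₂ n₃ *ᵥ y) := by
    rw [Matrix.dotProduct_mulVec, ← Matrix.mulVec_transpose, Matrix.mulVec_mulVec, hM,
      Matrix.one_mulVec]
  rw [key]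
  simp only [rowsOf, dotProduct, mulVec, Fin.sum_univ_three, Matrix.of_apply, Matrix.cons_val]
  ring

theorem statement1 (n₁ n₂ n₃ : V3) (h : IsOrthoFrame n₁ n₂ n₃)
    (A B : Matrix (Fin 3) (Fin 3) ℝ) :
    frob A B =
      (∑ k : Fin 3, (frob (Vmat n₁ n₂ n₃ k) (Vmat n₁ n₂ n₃ k))⁻¹ *
        (frob A (Vmat n₁ n₂ n₃ k) * frob B (Vmat n₁ n₂ n₃ k))) +
      ∑ k : Fin 6, (frob (Wmat n₁ n₂ n₃ k) (Wmat n₁ n₂ n₃ k))⁻¹ *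
        (frob A (Wmat n₁ n₂ n₃ k) * frob B (Wmat n₁ n₂ n₃ k)) := by
  have hA : frob A B = A 0 ⬝ᵥ B 0 + A 1 ⬝ᵥ B 1 + A 2 ⬝ᵥ B 2 := by
    simp [frob, dotProduct, Fin.sum_univ_three]
  rw [hA, parseval n₁ n₂ n₃ h (A 0), parseval n₁ n₂ n₃ h (A 1), parseval n₁ n₂ n₃ h (A 2)]
  obtain ⟨h1, h2, h3, h4, h5, h6⟩ := h
  simp only [Fin.sum_univ_three, Fin.sum_univ_six, Vmat, Wmat, Matrix.cons_val, frob_rowsOf]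
  simp only [rowsOf_zero, rowsOf_one, rowsOf_two, dotProduct_zero, dotProduct_neg,
    neg_dotProduct, h1, h2, h3]
  norm_num
  ring
end
end

section
/- Let p = (n₁, n₂, n₃) : ℝ³ → (ℝ³)³ be twice continuously differentiable with p(x) an orthonormal frame for every x, and let K₁,…,K₁₂ and γ₁, γ₂, γ₃ be real numbers. Define pointwise f_Bi = ½[ K₁(div n₁)² + K₂(div n₂)² + K₃(div n₃)² + K₄(n₁·curl n₁)² + K₅(n₂·curl n₂)² + K₆(n₃·curl n₃)² + K₇(n₃·curl n₁)² + K₈(n₁·curl n₂)² + K₉(n₂·curl n₃)² + K₁₀(n₂·curl n₁)² + K₁₁(n₃·curl n₂)² + K₁₂(n₁·curl n₃)² + γ₁ div((n₁·∇)n₁ − (div n₁)n₁) + γ₂ div((n₂·∇)n₂ − (div n₂)n₂) + γ₃ div((n₃·∇)n₃ − (div n₃)n₃) ]. Then pointwise f_Bi = ½(γ₁|∇n₁|² + γ₂|∇n₂|² + γ₃|∇n₃|²) + ½[ k₁(div n₁)² + k₂(div n₂)² + k₃(div n₃)² + Σ_{i,j=1}^{3} k_{ij}(n_i·curl n_j)²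 ], where k₁ = K₁−γ₁, k₂ = K₂−γ₂, k₃ = K₃−γ₃, k₁₁ = K₄−γ₁, k₂₂ = K₅−γ₂, k₃₃ = K₆−γ₃, k₃₁ = K₇−γ₁, k₁₂ = K₈−γ₂, k₂₃ = K₉−γ₃, k₂₁ = K₁₀−γ₁, k₃₂ = K₁₁−γ₂, k₁₃ = K₁₂−γ₃. -/
open Matrix

noncomputable section

/-- The partial derivative `∂ⱼ f` at `x` of a scalar function on `ℝ³`. -/
def pd (j : Fin 3) (f : (Fin 3 → ℝ) → ℝ) (x : Fin 3 → ℝ) : ℝ :=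
  fderiv ℝ f x (Pi.single j 1)

/-- The divergence of a vector field on `ℝ³`. -/
def vdiv (F : (Fin 3 → ℝ) → V3) (x : Fin 3 → ℝ) : ℝ :=
  ∑ i, pd i (fun y => F y i) x

/-- The curl of a vector field on `ℝ³`. -/
def vcurl (F : (Fin 3 → ℝ) → V3) (x : Fin 3 → ℝ) : V3 :=
  ![pd 1 (fun y => F y 2) x - pd 2 (fun y => F y 1) x,
    pd 2 (fun y => F y 0) x - pd 0 (fun y => F y 2) x,
    pd 0 (fun y => F y 1) x - pd 1 (fun y => F y 0) x]

/-- `|∇F|² = Σ_{i,j} (∂ⱼ Fⁱ)²` for a vector field on `ℝ³`. -/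
def gradNormSq (F : (Fin 3 → ℝ) → V3) (x : Fin 3 → ℝ) : ℝ :=
  ∑ i, ∑ j, (pd j (fun y => F y i) x) ^ 2

/-- The convective term `(F·∇)F`, with components `Σ_j F^j ∂_j F^i`. -/
def convect (F : (Fin 3 → ℝ) → V3) (x : Fin 3 → ℝ) : V3 :=
  fun i => ∑ j, F x j * pd j (fun y => F y i) x

lemma pd_add' {f g : (Fin 3 → ℝ) → ℝ} (hf : Differentiable ℝ f) (hg : Differentiable ℝ g)
    (j : Fin 3) (x : Fin 3 → ℝ) : pd j (fun y => f y + g y) x = pd j f x + pd j g x := by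
  unfold pd
  rw [fderiv_fun_add (hf x) (hg x)]; rfl

lemma pd_sub' {f g : (Fin 3 → ℝ) → ℝ} (hf : Differentiable ℝ f) (hg : Differentiable ℝ g)
    (j : Fin 3) (x : Fin 3 → ℝ) : pd j (fun y => f y - g y) x = pd j f x - pd j g x := by
  unfold pd
  rw [fderiv_fun_sub (hf x) (hg x)]; rfl

lemma pd_mul' {f g : (Fin 3 → ℝ) → ℝ} (hf : Differentiable ℝ f) (hg : Differentiable ℝ g)
    (j : Fin 3) (x : Fin 3 → ℝ) :
    pd j (fun y => f y * g y) x = f x * pd j g x + g x * pd j f x := by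
  unfold pd
  rw [fderiv_fun_mul (hf x) (hg x)]; simp

lemma pd_diff {f : (Fin 3 → ℝ) → ℝ} (hf : ContDiff ℝ 2 f) (j : Fin 3) :
    Differentiable ℝ (fun y => pd j f y) := by
  have h : ContDiff ℝ 1 (fderiv ℝ f) := hf.fderiv_right (by norm_num)
  exact fun y => ((h.differentiable (by norm_num)) y).clm_apply (differentiableAt_const _)

lemma pd_comm {f : (Fin 3 → ℝ) → ℝ} (hf : ContDiff ℝ 2 f) (i j : Fin 3) (x : Fin 3 → ℝ) :
    pd i (fun y => pd j f y) x = pd j (fun y => pd i f y) x := by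
  have h : ContDiff ℝ 1 (fderiv ℝ f) := hf.fderiv_right (by norm_num)
  have hd := h.differentiable (by norm_num) x
  have key : ∀ a b : Fin 3, pd a (fun y => pd b f y) x
      = fderiv ℝ (fderiv ℝ f) x (Pi.single a 1) (Pi.single b 1) := by
    intro a b
    unfold pd
    rw [fderiv_clm_apply hd (differentiableAt_const _)]
    simp
  rw [key, key]
  exact (hf.contDiffAt.isSymmSndFDerivAt (by simp)) _ _

lemma vdiv_null {F : (Fin 3 → ℝ) → V3} (hF : ContDiff ℝ 2 F) (x : Fin 3 → ℝ) :
    vdiv (fun y => convect F y - vdiv F y • F y) x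
      = gradNormSq F x - vcurl F x ⬝ᵥ vcurl F x - (vdiv F x) ^ 2 := by
  have hc : ∀ i, ContDiff ℝ 2 (fun y => F y i) := fun i => contDiff_pi.mp hF i
  have hd : ∀ i, Differentiable ℝ (fun y => F y i) :=
    fun i => (hc i).differentiable (by norm_num)
  have hp : ∀ i j, Differentiable ℝ (fun y => pd j (fun z => F z i) y) :=
    fun i j => pd_diff (hc i) j
  have key : ∀ i, pd i (fun y => (convect F y - vdiv F y • F y) i) x =
      (∑ j, (F x j * pd i (fun y => pd j (fun z => F z i) y) x
        + pd j (fun z => F z i) x * pd i (fun z => F z j) x))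
      - ((vdiv F x) * pd i (fun z => F z i) x
        + F x i * ∑ k, pd i (fun y => pd k (fun z => F z k) y) x) := by
    intro i
    simp only [convect, vdiv, Pi.sub_apply, Pi.smul_apply, smul_eq_mul, Fin.sum_univ_three]
    have m : ∀ j, Differentiable ℝ (fun y => F y j * pd j (fun z => F z i) y) :=
      fun j => (hd j).fun_mul (hp i j)
    have s2 := (hp 0 0).fun_add (hp 1 1)
    have s3 := s2.fun_add (hp 2 2)
    have t2 := (m 0).fun_add (m 1)
    rw [pd_sub' (t2.fun_add (m 2)) (s3.fun_mul (hd i)), pd_add' t2 (m 2), pd_add' (m 0) (m 1),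
      pd_mul' s3 (hd i), pd_add' s2 (hp 2 2), pd_add' (hp 0 0) (hp 1 1),
      pd_mul' (hd 0) (hp i 0), pd_mul' (hd 1) (hp i 1), pd_mul' (hd 2) (hp i 2)]
  rw [vdiv]
  simp only [key]
  simp only [vdiv, gradNormSq, vcurl, Fin.sum_univ_three, dotProduct, cons_val]
  rw [pd_comm (hc 0) 1 0, pd_comm (hc 0) 2 0, pd_comm (hc 1) 1 0, pd_comm (hc 1) 2 1,
    pd_comm (hc 2) 2 0, pd_comm (hc 2) 2 1]
  ring

lemma parseval_s7 {a b c : V3} (h : IsOrthoFrame a b c) (v : V3) :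
    v ⬝ᵥ v = (a ⬝ᵥ v) ^ 2 + (b ⬝ᵥ v) ^ 2 + (c ⬝ᵥ v) ^ 2 := by
  obtain ⟨h1, h2, h3, h4, h5, h6⟩ := h
  let A : Matrix (Fin 3) (Fin 3) ℝ := ![a, b, c]
  have hA : A * Aᵀ = 1 := by
    ext i j
    have : (A * Aᵀ) i j = A i ⬝ᵥ A j := rfl
    rw [this]
    fin_cases i <;> fin_cases j <;> simp [A, h1, h2, h3, h4, h5, h6, dotProduct_comm b a,
      dotProduct_comm c a, dotProduct_comm c b]
  have hB : Aᵀ * A = 1 := mul_eq_one_comm.mp hA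
  have e : (A *ᵥ v) ⬝ᵥ (A *ᵥ v) = v ⬝ᵥ v := by
    rw [dotProduct_mulVec, ← mulVec_transpose, mulVec_mulVec, hB, one_mulVec]
  rw [← e]
  have : ∀ i, (A *ᵥ v) i = A i ⬝ᵥ v := fun _ => rfl
  rw [dotProduct, Fin.sum_univ_three]
  simp only [this]
  simp only [A, cons_val]
  ring

theorem statement7 (n₁ n₂ n₃ : (Fin 3 → ℝ) → V3)
    (h1 : ContDiff ℝ 2 n₁) (h2 : ContDiff ℝ 2 n₂) (h3 : ContDiff ℝ 2 n₃)
    (hframe : ∀ x, IsOrthoFrame (n₁ x) (n₂ x) (n₃ x))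
    (K₁ K₂ K₃ K₄ K₅ K₆ K₇ K₈ K₉ K₁₀ K₁₁ K₁₂ γ₁ γ₂ γ₃ : ℝ) :
    ∀ x,
      (1 / 2) * (K₁ * (vdiv n₁ x) ^ 2 + K₂ * (vdiv n₂ x) ^ 2 + K₃ * (vdiv n₃ x) ^ 2
        + K₄ * (n₁ x ⬝ᵥ vcurl n₁ x) ^ 2 + K₅ * (n₂ x ⬝ᵥ vcurl n₂ x) ^ 2
        + K₆ * (n₃ x ⬝ᵥ vcurl n₃ x) ^ 2
        + K₇ * (n₃ x ⬝ᵥ vcurl n₁ x) ^ 2 + K₈ * (n₁ x ⬝ᵥ vcurl n₂ x) ^ 2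
        + K₉ * (n₂ x ⬝ᵥ vcurl n₃ x) ^ 2
        + K₁₀ * (n₂ x ⬝ᵥ vcurl n₁ x) ^ 2 + K₁₁ * (n₃ x ⬝ᵥ vcurl n₂ x) ^ 2
        + K₁₂ * (n₁ x ⬝ᵥ vcurl n₃ x) ^ 2
        + γ₁ * vdiv (fun y => convect n₁ y - vdiv n₁ y • n₁ y) x
        + γ₂ * vdiv (fun y => convect n₂ y - vdiv n₂ y • n₂ y) x
        + γ₃ * vdiv (fun y => convect n₃ y - vdiv n₃ y • n₃ y) x)
      =
      (1 / 2) * (γ₁ * gradNormSq n₁ x + γ₂ * gradNormSq n₂ x + γ₃ * gradNormSq n₃ x)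
      + (1 / 2) * ((K₁ - γ₁) * (vdiv n₁ x) ^ 2 + (K₂ - γ₂) * (vdiv n₂ x) ^ 2
        + (K₃ - γ₃) * (vdiv n₃ x) ^ 2
        + (K₄ - γ₁) * (n₁ x ⬝ᵥ vcurl n₁ x) ^ 2
        + (K₈ - γ₂) * (n₁ x ⬝ᵥ vcurl n₂ x) ^ 2
        + (K₁₂ - γ₃) * (n₁ x ⬝ᵥ vcurl n₃ x) ^ 2
        + (K₁₀ - γ₁) * (n₂ x ⬝ᵥ vcurl n₁ x) ^ 2
        + (K₅ - γ₂) * (n₂ x ⬝ᵥ vcurl n₂ x) ^ 2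
        + (K₉ - γ₃) * (n₂ x ⬝ᵥ vcurl n₃ x) ^ 2
        + (K₇ - γ₁) * (n₃ x ⬝ᵥ vcurl n₁ x) ^ 2
        + (K₁₁ - γ₂) * (n₃ x ⬝ᵥ vcurl n₂ x) ^ 2
        + (K₆ - γ₃) * (n₃ x ⬝ᵥ vcurl n₃ x) ^ 2) := by
  intro x
  rw [vdiv_null h1, vdiv_null h2, vdiv_null h3, parseval_s7 (hframe x) (vcurl n₁ x),
    parseval_s7 (hframe x) (vcurl n₂ x), parseval_s7 (hframe x) (vcurl n₃ x)]
  ring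
end
end
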